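/- Let X be the mixture of two i.i.d. sources X₁, X₂ with entropies H(X₁) ≥ H(X₂), mixed with weights w(1), w(2) > 0, w(1)+w(2)=1. Then the infimum of ε-achievable first-order overflow thresholds satisfies R(ε|X) = H(X₁)/α_c for 0 ≤ ε < w(1), and R(ε|X) = H(X₂)/α_c for w(1) ≤ ε < 1. -/

import Mathlib

/-- Additive cost of a string over the code alphabet. -/
noncomputable def strCost {U : Type*} (c : U → ℝ) (s : List U) : ℝ := (s.map c).sum

/-- Probability of a set under a (real-valued) distribution. -/
noncomputable def prob {X : Type*} (P : X → ℝ) (S : Set X) : ℝ := ∑' x, S.indicator P x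

open Filter Topology

section PrefixFree

variable {U : Type*}

/-- No member of `S` is a proper prefix of another one. -/
def PrefixFree (S : Set (List U)) : Prop :=
  ∀ s ∈ S, ∀ t ∈ S, s <+: t → s = t

lemma strCost_nil (c : U → ℝ) : strCost c [] = 0 := by simp [strCost]

lemma strCost_cons (c : U → ℝ) (u : U) (s : List U) :
    strCost c (u :: s) = c u + strCost c s := by simp [strCost]

lemma sum_rpow_sub [Fintype U] {b α : ℝ} (hb : 1 < b) {c : U → ℝ}
    (hroot : ∑ u : U, b ^ (-(α * c u)) = 1) (T : ℝ) :
    ∑ u : U, b ^ (α * (T - c u)) = b ^ (α * T) := by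
  have h : ∀ u : U, b ^ (α * (T - c u)) = b ^ (α * T) * b ^ (-(α * c u)) := fun u => by
    rw [← Real.rpow_add (by linarith)]
    ring_nf
  simp_rw [h]
  rw [← Finset.mul_sum, hroot, mul_one]

/-- A prefix-free set of strings of cost at most `T` has at most `b ^ (α * T)` elements. -/
lemma PrefixFree.card_le [Fintype U] {b α : ℝ} (hb : 1 < b) (hα : 0 < α) {c : U → ℝ}
    (hroot : ∑ u : U, b ^ (-(α * c u)) = 1)
    {S : Finset (List U)} (hS : PrefixFree (S : Set (List U))) {T : ℝ}
    (hT : ∀ s ∈ S, strCost c s ≤ T) : (S.card : ℝ) ≤ b ^ (α * T) := by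
  classical
  have key : ∀ (N : ℕ) (S : Finset (List U)) (T : ℝ), PrefixFree (S : Set (List U)) →
      (∀ s ∈ S, strCost c s ≤ T) → (∀ s ∈ S, s.length ≤ N) → (S.card : ℝ) ≤ b ^ (α * T) := by
    intro N
    induction N with
    | zero =>
      intro S T _ hT hN
      have hsub : S ⊆ {[]} := fun s hs => by simpa using hN s hs
      rcases Finset.subset_singleton_iff.1 hsub with rfl | rfl
      · simp only [Finset.card_empty, Nat.cast_zero]
        positivity
      · have h0 : 0 ≤ T := by simpa [strCost_nil] using hT [] (by simp)
        simpa using Real.one_le_rpow hb.le (by positivity)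
    | succ N ih =>
      intro S T hS hT hN
      by_cases hnil : [] ∈ S
      · have hsub : S = {[]} := by
          refine Finset.eq_singleton_iff_unique_mem.2 ⟨hnil, fun s hs => ?_⟩
          exact (hS [] hnil s hs (by simp)).symm
        have h0 : 0 ≤ T := by simpa [strCost_nil] using hT [] hnil
        rw [hsub]
        simpa using Real.one_le_rpow hb.le (by positivity)
      · set R : U → Finset (List U) := fun u =>
          S.preimage (List.cons u) (List.cons_injective.injOn) with hR
        have hmem : ∀ u s, s ∈ R u ↔ u :: s ∈ S := fun u s => by simp [hR]
        have hcover : S ⊆ Finset.univ.biUnion (fun u => (R u).image (List.cons u)) := by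
          intro s hs
          cases s with
          | nil => exact absurd hs hnil
          | cons u s => simpa [hmem] using hs
        have hcard : (S.card : ℝ) ≤ ∑ u, ((R u).card : ℝ) := by
          have h1 := (Finset.card_le_card hcover).trans Finset.card_biUnion_le
          have h2 : ∑ u, ((R u).image (List.cons u)).card ≤ ∑ u, (R u).card :=
            Finset.sum_le_sum fun u _ => Finset.card_image_le
          exact_mod_cast h1.trans h2
        rw [← sum_rpow_sub hb hroot T]
        refine hcard.trans (Finset.sum_le_sum fun u _ => ih (R u) (T - c u) ?_ ?_ ?_)
        · intro s hs t ht hst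
          have := hS (u :: s) ((hmem u s).1 hs) (u :: t) ((hmem u t).1 ht) (by simpa using hst)
          simpa using this
        · intro s hs
          have := hT _ ((hmem u s).1 hs)
          rw [strCost_cons] at this
          linarith
        · intro s hs
          simpa using hN _ ((hmem u s).1 hs)
  exact key (S.sup List.length) S T hS hT fun s hs => Finset.le_sup (f := List.length) hs

/-- There are prefix-free sets of strings of cost at most `T` whose size is `b ^ (α * T)` up to a
multiplicative constant. -/
lemma exists_prefixFree_card_ge [Fintype U] {b α : ℝ} (hb : 1 < b) (hα : 0 < α)
    {c : U → ℝ} (hc : ∀ u, 0 < c u) (hroot : ∑ u : U, b ^ (-(α * c u)) = 1)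
    {D : ℝ} (hD : ∀ u, c u ≤ D) {T : ℝ} (hT : 0 ≤ T) :
    ∃ S : Finset (List U), PrefixFree (S : Set (List U)) ∧ (∀ s ∈ S, strCost c s ≤ T) ∧
      b ^ (α * (T - D)) ≤ S.card := by
  classical
  obtain ⟨m, hm0, hm⟩ : ∃ m : ℝ, 0 < m ∧ ∀ u, m ≤ c u := by
    have hne : Nonempty U := by
      by_contra h
      rw [not_nonempty_iff] at h
      simp at hroot
    obtain ⟨u, hu⟩ := Finite.exists_min c
    exact ⟨c u, hc u, hu⟩
  have key : ∀ (N : ℕ) (T : ℝ), 0 ≤ T → T < N * m →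
      ∃ S : Finset (List U), PrefixFree (S : Set (List U)) ∧ (∀ s ∈ S, strCost c s ≤ T) ∧
        b ^ (α * (T - D)) ≤ S.card := by
    intro N
    induction N with
    | zero =>
      intro T h0 h1
      simp only [Nat.cast_zero, zero_mul] at h1
      linarith
    | succ N ih =>
      intro T h0 h1
      by_cases hTD : T < D
      · refine ⟨{[]}, ?_, ?_, ?_⟩
        · intro s hs t ht _
          simp only [Finset.coe_singleton, Set.mem_singleton_iff] at hs ht
          rw [hs, ht]
        · simpa [strCost_nil] using h0
        · simpa using Real.rpow_le_one_of_one_le_of_nonpos hb.le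
            (mul_nonpos_of_nonneg_of_nonpos hα.le (by linarith))
      · push Not at hTD
        push_cast at h1
        choose R hRp hRc hRn using fun u => ih (T - c u) (by linarith [hD u])
          (by linarith [hm u])
        refine ⟨Finset.univ.biUnion (fun u => (R u).image (List.cons u)), ?_, ?_, ?_⟩
        · intro s hs t ht hst
          simp only [Finset.coe_biUnion, Finset.coe_univ, Set.mem_univ, Finset.coe_image,
            Set.iUnion_true, Set.mem_iUnion, Set.mem_image, Finset.mem_coe] at hs ht
          obtain ⟨u, s, hs, rfl⟩ := hs
          obtain ⟨v, t, ht, rfl⟩ := ht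
          rw [List.cons_prefix_cons] at hst
          obtain ⟨rfl, hst⟩ := hst
          rw [hRp u s hs t ht hst]
        · intro s hs
          simp only [Finset.mem_biUnion, Finset.mem_univ, true_and, Finset.mem_image] at hs
          obtain ⟨u, s, hs, rfl⟩ := hs
          rw [strCost_cons]
          linarith [hRc u s hs]
        · rw [Finset.card_biUnion]
          · rw [← sum_rpow_sub hb hroot (T - D)]
            push_cast
            refine Finset.sum_le_sum fun u _ => ?_
            rw [Finset.card_image_of_injective _ List.cons_injective]
            rw [sub_right_comm]
            exact hRn u
          · intro u _ v _ huv
            refine Finset.disjoint_left.2 ?_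
            intro s hs ht
            simp only [Finset.mem_image] at hs ht
            obtain ⟨s, _, rfl⟩ := hs
            obtain ⟨t, _, h⟩ := ht
            exact huv (List.cons.inj h).1.symm
  obtain ⟨N, hN⟩ := exists_nat_gt (T / m)
  exact key N T hT ((div_lt_iff₀ hm0).1 hN)

lemma eq_of_prefix_replicate_append {u v : U} (huv : u ≠ v) :
    ∀ {k m : ℕ}, List.replicate k u ++ [v] <+: List.replicate m u ++ [v] → k = m
  | 0, 0, _ => rfl
  | 0, m + 1, h => by
    simp only [List.replicate_succ, List.replicate_zero, List.nil_append, List.cons_append,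
      List.cons_prefix_cons] at h
    exact absurd h.1.symm huv
  | k + 1, 0, h => by
    simp only [List.replicate_succ, List.replicate_zero, List.nil_append, List.cons_append,
      List.cons_prefix_cons] at h
    exact absurd h.1 huv
  | k + 1, m + 1, h => by
    simp only [List.replicate_succ, List.cons_append, List.cons_prefix_cons, true_and] at h
    rw [eq_of_prefix_replicate_append huv h]

/-- An injective prefix code without the empty codeword. -/
def IsPrefixCode {Y : Type*} (φ : Y → List U) : Prop :=
  Function.Injective φ ∧ (∀ x, φ x ≠ []) ∧ ∀ x y, φ x <+: φ y → φ x = φ y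

/-- A prefix code for a countable set that is cheap on a given finite set `A`. The elements outside
`A` are encoded by an escape codeword followed by a unary code. -/
lemma exists_isPrefixCode [Fintype U] [Nontrivial U] {b α : ℝ} (hb : 1 < b) (hα : 0 < α)
    {c : U → ℝ} (hc : ∀ u, 0 < c u) (hroot : ∑ u : U, b ^ (-(α * c u)) = 1)
    {D : ℝ} (hD : ∀ u, c u ≤ D) {T : ℝ} (hT : 0 ≤ T) {Y : Type*} [Countable Y]
    (A : Finset Y) (hA : (A.card : ℝ) + 1 ≤ b ^ (α * (T - D))) :
    ∃ φ : Y → List U, IsPrefixCode φ ∧ ∀ x ∈ A, strCost c (φ x) ≤ T + D := by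
  classical
  obtain ⟨S, hSp, hSc, hSn⟩ := exists_prefixFree_card_ge hb hα hc hroot hD hT
  obtain ⟨u, v, huv⟩ := exists_pair_ne U
  obtain ⟨e, he⟩ := Countable.exists_injective_nat Y
  obtain ⟨f⟩ : Nonempty (Option A ↪ S) := by
    apply Function.Embedding.nonempty_of_card_le
    simp only [Fintype.card_option, Fintype.card_coe]
    exact_mod_cast hA.trans hSn
  have hf : ∀ a a' : Option A, (f a : List U) <+: f a' → a = a' := fun a a' h =>
    f.injective (Subtype.ext (hSp _ (f a).2 _ (f a').2 h))
  set φ : Y → List U := fun x =>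
    u :: (if h : x ∈ A then (f (some ⟨x, h⟩) : List U)
      else (f none : List U) ++ (List.replicate (e x) u ++ [v])) with hφ
  have key : ∀ x y, φ x <+: φ y → x = y := by
    intro x y h
    simp only [hφ, List.cons_prefix_cons, true_and] at h
    by_cases hx : x ∈ A <;> by_cases hy : y ∈ A <;> simp only [hx, hy, dif_pos, dif_neg,
      not_false_eq_true] at h
    · simpa using hf _ _ h
    · rcases List.prefix_or_prefix_of_prefix h (List.prefix_append _ _) with h | h
      · simpa using hf _ _ h
      · simpa using hf _ _ h
    · simpa using hf _ _ ((List.prefix_append _ _).trans h)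
    · rw [List.prefix_append_right_inj] at h
      exact he (eq_of_prefix_replicate_append huv h)
  refine ⟨φ, ⟨fun x y h => key x y (h ▸ List.prefix_rfl), fun x => by simp [hφ],
    fun x y h => by rw [key x y h]⟩, fun x hx => ?_⟩
  simp only [hφ, hx, dif_pos, strCost_cons]
  linarith [hSc _ (f (some ⟨x, hx⟩)).2, hD u]

end PrefixFree

section Prob

variable {Y : Type*} {Q : Y → ℝ}

lemma prob_nonneg (hQ0 : ∀ x, 0 ≤ Q x) (S : Set Y) : 0 ≤ prob Q S :=
  tsum_nonneg fun x => Set.indicator_nonneg (fun x _ => hQ0 x) x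

lemma prob_mono (hQ0 : ∀ x, 0 ≤ Q x) (hQ : Summable Q) {S T : Set Y}
    (h : ∀ x ∈ S, 0 < Q x → x ∈ T) : prob Q S ≤ prob Q T := by
  refine (hQ.indicator S).tsum_le_tsum (fun x => ?_) (hQ.indicator T)
  by_cases hx : x ∈ S
  · rcases (hQ0 x).eq_or_lt with h0 | h0
    · rw [Set.indicator_of_mem hx, ← h0]
      exact Set.indicator_nonneg (fun x _ => hQ0 x) x
    · rw [Set.indicator_of_mem hx, Set.indicator_of_mem (h x hx h0)]
  · rw [Set.indicator_of_notMem hx]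
    exact Set.indicator_nonneg (fun x _ => hQ0 x) x

lemma prob_le_one (hQ0 : ∀ x, 0 ≤ Q x) (hQ : HasSum Q 1) (S : Set Y) : prob Q S ≤ 1 := by
  have := prob_mono hQ0 hQ.summable (S := S) (T := Set.univ) (fun x _ _ => trivial)
  rwa [show prob Q Set.univ = 1 by simp [prob, hQ.tsum_eq]] at this

lemma prob_add_mul {Q' : Y → ℝ} (hQ : Summable Q) (hQ' : Summable Q') (w w' : ℝ) (S : Set Y) :
    prob (fun x => w * Q x + w' * Q' x) S = w * prob Q S + w' * prob Q' S := by
  unfold prob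
  rw [← tsum_mul_left, ← tsum_mul_left,
    ← ((hQ.indicator S).mul_left w).tsum_add ((hQ'.indicator S).mul_left w')]
  refine tsum_congr fun x => ?_
  by_cases hx : x ∈ S <;> simp [hx]

/-- Finitely many points have probability at least `b ^ (-r)`, and there are at most `b ^ r` of
them. -/
lemma exists_finset_of_le_prob {b : ℝ} (hb : 1 < b) (hQ0 : ∀ x, 0 ≤ Q x) (hQ : HasSum Q 1)
    (r : ℝ) : ∃ A : Finset Y, (∀ x, b ^ (-r) ≤ Q x → x ∈ A) ∧ (A.card : ℝ) ≤ b ^ r := by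
  have hb0 : 0 < b := by linarith
  have hfin : {x | b ^ (-r) ≤ Q x}.Finite := by
    have h := hQ.summable.tendsto_cofinite_zero.eventually_lt_const (Real.rpow_pos_of_pos hb0 (-r))
    simpa [Filter.eventually_cofinite] using h
  refine ⟨hfin.toFinset, fun x hx => by simpa using hx, ?_⟩
  have h1 : (hfin.toFinset.card : ℝ) * b ^ (-r) ≤ ∑ x ∈ hfin.toFinset, Q x := by
    rw [← nsmul_eq_mul]
    exact Finset.card_nsmul_le_sum _ _ _ fun x hx => by simpa using hx
  have h2 : ∑ x ∈ hfin.toFinset, Q x ≤ 1 := sum_le_hasSum _ (fun x _ => hQ0 x) hQ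
  have h3 := h1.trans h2
  have h4 : b ^ (-r) * b ^ r = 1 := by rw [← Real.rpow_add hb0]; simp
  nlinarith [Real.rpow_pos_of_pos hb0 r]

/-- Lower bound on the overflow probability of a prefix code. -/
lemma IsPrefixCode.one_le_prob_overflow {U : Type*} [Fintype U] {b α : ℝ} (hb : 1 < b)
    (hα : 0 < α) {c : U → ℝ} (hroot : ∑ u : U, b ^ (-(α * c u)) = 1)
    (hQ0 : ∀ x, 0 ≤ Q x) (hQ : HasSum Q 1) {φ : Y → List U} (hφ : IsPrefixCode φ) (T r : ℝ) :
    1 ≤ prob Q {x | T < strCost c (φ x)} + b ^ (α * T) * b ^ (-r) +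
      prob Q {x | Real.logb b (Q x)⁻¹ < r} := by
  classical
  have hb0 : 0 < b := by linarith
  set G : Set Y := {x | strCost c (φ x) ≤ T ∧ Q x ≤ b ^ (-r)} with hG
  have hGle : prob Q G ≤ b ^ (α * T) * b ^ (-r) := by
    refine Real.tsum_le_of_sum_le (fun x => Set.indicator_nonneg (fun x _ => hQ0 x) x)
      fun F => ?_
    simp_rw [Set.indicator_apply]
    rw [← Finset.sum_filter]
    have hcard : ((F.filter (fun x => x ∈ G)).card : ℝ) ≤ b ^ (α * T) := by
      rw [← Finset.card_image_of_injective _ hφ.1]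
      refine PrefixFree.card_le hb hα hroot ?_ ?_
      · intro s hs t ht h
        simp only [Finset.coe_image, Set.mem_image] at hs ht
        obtain ⟨x, _, rfl⟩ := hs
        obtain ⟨y, _, rfl⟩ := ht
        exact hφ.2.2 x y h
      · intro s hs
        simp only [Finset.mem_image, Finset.mem_filter] at hs
        obtain ⟨x, hx, rfl⟩ := hs
        exact hx.2.1
    calc ∑ x ∈ F.filter (fun x => x ∈ G), Q x
        ≤ (F.filter (fun x => x ∈ G)).card • b ^ (-r) :=
          Finset.sum_le_card_nsmul _ _ _ fun x hx => (Finset.mem_filter.1 hx).2.2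
      _ ≤ b ^ (α * T) * b ^ (-r) := by
          rw [nsmul_eq_mul]
          gcongr
  have hs := hQ.summable
  have hsum : (1 : ℝ) ≤ prob Q {x | T < strCost c (φ x)} + prob Q G +
      prob Q {x | Real.logb b (Q x)⁻¹ < r} := by
    unfold prob
    rw [← hQ.tsum_eq, ← (hs.indicator _).tsum_add (hs.indicator _),
      ← ((hs.indicator _).add (hs.indicator _)).tsum_add (hs.indicator _)]
    refine hs.tsum_le_tsum (fun x => ?_)
      (((hs.indicator _).add (hs.indicator _)).add (hs.indicator _))
    have h0 : ∀ S : Set Y, 0 ≤ S.indicator Q x := fun S =>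
      Set.indicator_nonneg (fun x _ => hQ0 x) x
    by_cases h1 : T < strCost c (φ x)
    · rw [Set.indicator_of_mem (s := {x | T < strCost c (φ x)}) h1]
      linarith [h0 G, h0 {x | Real.logb b (Q x)⁻¹ < r}]
    by_cases h2 : Q x ≤ b ^ (-r)
    · rw [Set.indicator_of_mem (s := G) ⟨not_lt.1 h1, h2⟩]
      linarith [h0 {x | T < strCost c (φ x)}, h0 {x | Real.logb b (Q x)⁻¹ < r}]
    · have h3 : Real.logb b (Q x)⁻¹ < r := by
        push Not at h2
        have := Real.logb_lt_logb hb (Real.rpow_pos_of_pos hb0 _) h2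
        rw [Real.logb_rpow hb0 hb.ne'] at this
        rw [Real.logb_inv]
        linarith
      rw [Set.indicator_of_mem (s := {x | Real.logb b (Q x)⁻¹ < r}) h3]
      linarith [h0 {x | T < strCost c (φ x)}, h0 G]
  linarith

lemma hasSum_prod_pi {X : Type*} {P : X → ℝ} (hP0 : ∀ x, 0 ≤ P x) (hP : HasSum P 1) (n : ℕ) :
    HasSum (fun x : Fin n → X => ∏ i, P (x i)) 1 := by
  induction n with
  | zero => simp
  | succ n ih =>
    have hs : Summable fun p : X × (Fin n → X) => P p.1 * ∏ i, P (p.2 i) :=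
      Summable.mul_of_nonneg (f := P) (g := fun x : Fin n → X => ∏ i, P (x i)) hP.summable
        ih.summable hP0 (fun x => Finset.prod_nonneg fun i _ => hP0 _)
    have h := HasSum.mul (f := P) (g := fun x : Fin n → X => ∏ i, P (x i)) hP ih hs
    rw [mul_one] at h
    have hcons : (fun x : Fin (n + 1) → X => ∏ i, P (x i)) ∘ (Fin.consEquiv fun _ => X) =
        fun p : X × (Fin n → X) => P p.1 * ∏ i, P (p.2 i) := by
      ext p
      simp [Fin.prod_univ_succ, Fin.consEquiv]
    rwa [← hcons, Equiv.hasSum_iff] at h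

end Prob

section Limits

lemma limsup_le_of_le_tendsto {f g : ℕ → ℝ} {L ε : ℝ} (hf : ∀ n, 0 ≤ f n)
    (hfg : ∀ᶠ n in atTop, f n ≤ g n) (hg : Tendsto g atTop (𝓝 L)) (hL : L ≤ ε) :
    limsup f atTop ≤ ε := by
  refine le_trans (limsup_le_limsup hfg ?_ hg.isBoundedUnder_le) (hg.limsup_eq.le.trans hL)
  exact IsBoundedUnder.isCoboundedUnder_le (isBoundedUnder_of ⟨0, hf⟩)

lemma le_of_tendsto_le_limsup {f g : ℕ → ℝ} {L ε : ℝ} (hf : ∀ n, f n ≤ 1)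
    (hgf : ∀ᶠ n in atTop, g n ≤ f n) (hg : Tendsto g atTop (𝓝 L)) (h : limsup f atTop ≤ ε) :
    L ≤ ε := by
  refine (hg.limsup_eq.symm.le.trans (limsup_le_limsup hgf ?_ ?_)).trans h
  · exact hg.isBoundedUnder_ge.isCoboundedUnder_le
  · exact isBoundedUnder_of ⟨1, hf⟩

lemma sInf_eq_of_forall_lt_mem {S : Set ℝ} {a : ℝ} (h1 : ∀ R, a < R → R ∈ S)
    (h2 : ∀ R ∈ S, a ≤ R) : sInf S = a := by
  refine le_antisymm (le_of_forall_gt_imp_ge_of_dense fun R hR => csInf_le ⟨a, h2⟩ (h1 R hR))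
    (le_csInf ⟨a + 1, h1 _ (by linarith)⟩ h2)

lemma tendsto_rpow_natCast_mul_zero {b t : ℝ} (hb : 1 < b) (ht : t < 0) :
    Tendsto (fun n : ℕ => b ^ ((n : ℝ) * t)) atTop (𝓝 0) := by
  have hb0 : 0 < b := by linarith
  have h : ∀ n : ℕ, b ^ ((n : ℝ) * t) = (b ^ t) ^ n := fun n => by
    rw [mul_comm, Real.rpow_mul_natCast hb0.le]
  simp_rw [h]
  exact tendsto_pow_atTop_nhds_zero_of_lt_one (Real.rpow_nonneg hb0.le _)
    (Real.rpow_lt_one_of_one_lt_of_neg hb ht)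

end Limits

section Coding

variable {U : Type*} [Fintype U] {b α : ℝ} {c : U → ℝ} {Y : ℕ → Type*} {Q : ∀ n, Y n → ℝ}

/-- Strong converse for sources obeying the weak law of large numbers. -/
lemma exists_tendsto_one_le_overflow (hb : 1 < b) (hα : 0 < α)
    (hroot : ∑ u : U, b ^ (-(α * c u)) = 1)
    (hQ0 : ∀ n x, 0 ≤ Q n x) (hQ : ∀ n, HasSum (Q n) 1) {H : ℝ}
    (hW : ∀ δ : ℝ, 0 < δ → Tendsto (fun n : ℕ => prob (Q n)
      {x | δ < |(1 / (n : ℝ)) * Real.logb b (Q n x)⁻¹ - H|}) atTop (𝓝 0))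
    {φ : ∀ n, Y n → List U} (hφ : ∀ n, IsPrefixCode (φ n)) {R : ℝ} (hR : R < H / α) :
    ∃ g : ℕ → ℝ, Tendsto g atTop (𝓝 1) ∧
      ∀ᶠ n : ℕ in atTop, g n ≤ prob (Q n) {x | (n : ℝ) * R < strCost c (φ n x)} := by
  have hb0 : 0 < b := by linarith
  rw [lt_div_iff₀ hα] at hR
  set δ : ℝ := (H - R * α) / 2 with hδ
  have hδ0 : 0 < δ := by linarith
  have ht : α * R - (H - δ) < 0 := by linarith
  refine ⟨fun n => 1 - b ^ ((n : ℝ) * (α * R - (H - δ))) - prob (Q n)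
      {x | δ / 2 < |(1 / (n : ℝ)) * Real.logb b (Q n x)⁻¹ - H|}, ?_, ?_⟩
  · simpa using ((tendsto_const_nhds (x := (1 : ℝ))).sub
      (tendsto_rpow_natCast_mul_zero hb ht)).sub (hW (δ / 2) (by linarith))
  · filter_upwards [eventually_gt_atTop 0] with n hn
    have hn' : (0 : ℝ) < n := by exact_mod_cast hn
    have h := (hφ n).one_le_prob_overflow hb hα hroot (hQ0 n) (hQ n) (n * R) (n * (H - δ))
    rw [← Real.rpow_add hb0,
      show α * (n * R) + -(n * (H - δ)) = (n : ℝ) * (α * R - (H - δ)) by ring] at h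
    have h2 : prob (Q n) {x | Real.logb b (Q n x)⁻¹ < n * (H - δ)} ≤ prob (Q n)
        {x | δ / 2 < |(1 / (n : ℝ)) * Real.logb b (Q n x)⁻¹ - H|} := by
      refine prob_mono (hQ0 n) (hQ n).summable fun x hx _ => ?_
      simp only [Set.mem_ofPred_eq] at hx ⊢
      have : (1 / (n : ℝ)) * Real.logb b (Q n x)⁻¹ < H - δ := by
        rw [one_div, inv_mul_lt_iff₀ hn']
        exact hx
      rw [lt_abs]
      right
      linarith
    linarith

/-- A sequence of sets of exponential rate `h < α * R` admits prefix codes whose cost on these sets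
is eventually at most `n * R`. -/
lemma exists_isPrefixCode_seq [Nontrivial U] [∀ n, Countable (Y n)] (hb : 1 < b) (hα : 0 < α)
    (hc : ∀ u, 0 < c u) (hroot : ∑ u : U, b ^ (-(α * c u)) = 1) {h R : ℝ} (h0 : 0 ≤ h)
    (hR : h < α * R) (A : ∀ n, Finset (Y n))
    (hA : ∀ n, ((A n).card : ℝ) ≤ 2 * b ^ ((n : ℝ) * h)) :
    ∃ φ : ∀ n, Y n → List U, (∀ n, IsPrefixCode (φ n)) ∧
      ∀ᶠ n : ℕ in atTop, ∀ x ∈ A n, strCost c (φ n x) ≤ n * R := by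
  have hb0 : 0 < b := by linarith
  obtain ⟨D, hD⟩ : ∃ D, ∀ u, c u ≤ D :=
    (Finite.exists_max c).imp' c fun u hu => hu
  have hD0 : 0 < D := (hc (Classical.arbitrary U)).trans_le (hD _)
  have hR0 : 0 < R := by
    by_contra hneg
    nlinarith
  have hcode : ∀ n : ℕ, ∃ φ : Y n → List U, IsPrefixCode φ ∧
      (0 ≤ n * R - D ∧ ((A n).card : ℝ) + 1 ≤ b ^ (α * (n * R - D - D)) →
        ∀ x ∈ A n, strCost c (φ x) ≤ n * R) := by
    intro n
    by_cases hn : 0 ≤ n * R - D ∧ ((A n).card : ℝ) + 1 ≤ b ^ (α * (n * R - D - D))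
    · obtain ⟨φ, hφ, hφc⟩ := exists_isPrefixCode hb hα hc hroot hD hn.1 (A n) hn.2
      exact ⟨φ, hφ, fun _ x hx => by linarith [hφc x hx]⟩
    · obtain ⟨φ, hφ, -⟩ := exists_isPrefixCode hb hα hc hroot hD hD0.le (∅ : Finset (Y n))
        (by simp)
      exact ⟨φ, hφ, fun h => absurd h hn⟩
  choose φ hφ hφc using hcode
  refine ⟨φ, hφ, ?_⟩
  have e1 : ∀ᶠ n : ℕ in atTop, D ≤ n * R :=
    (tendsto_natCast_atTop_atTop.atTop_mul_const hR0).eventually_ge_atTop D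
  have e2 : ∀ᶠ n : ℕ in atTop, b ^ ((n : ℝ) * (h - α * R)) < b ^ (-(2 * α * D)) / 3 :=
    (tendsto_rpow_natCast_mul_zero hb (by linarith)).eventually_lt_const
      (by have := Real.rpow_pos_of_pos hb0 (-(2 * α * D)); positivity)
  filter_upwards [e1, e2] with n h1 h2
  refine hφc n ⟨by linarith, ?_⟩
  have h3 : (1 : ℝ) ≤ b ^ ((n : ℝ) * h) := Real.one_le_rpow hb.le (by positivity)
  have h4 : b ^ ((n : ℝ) * h) = b ^ ((n : ℝ) * (h - α * R)) * b ^ (n * (α * R)) := by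
    rw [← Real.rpow_add hb0]
    ring_nf
  have h5 : b ^ (α * (n * R - D - D)) = b ^ (-(2 * α * D)) * b ^ (n * (α * R)) := by
    rw [← Real.rpow_add hb0]
    ring_nf
  have h6 := mul_lt_mul_of_pos_right h2 (Real.rpow_pos_of_pos hb0 (n * (α * R)))
  rw [h5]
  linarith [hA n]

/-- The complement of the high-probability points is asymptotically negligible. -/
lemma exists_finset_seq_of_wlln (hb : 1 < b) (hQ0 : ∀ n x, 0 ≤ Q n x) (hQ : ∀ n, HasSum (Q n) 1)
    {H h : ℝ} (hHh : H < h)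
    (hW : ∀ δ : ℝ, 0 < δ → Tendsto (fun n : ℕ => prob (Q n)
      {x | δ < |(1 / (n : ℝ)) * Real.logb b (Q n x)⁻¹ - H|}) atTop (𝓝 0)) :
    ∃ A : ∀ n, Finset (Y n), (∀ n, ((A n).card : ℝ) ≤ b ^ ((n : ℝ) * h)) ∧
      Tendsto (fun n => prob (Q n) {x | x ∉ A n}) atTop (𝓝 0) := by
  have hb0 : 0 < b := by linarith
  choose A hA hAc using fun n : ℕ => exists_finset_of_le_prob hb (hQ0 n) (hQ n) (n * h)
  refine ⟨A, hAc, squeeze_zero' (Eventually.of_forall fun n => prob_nonneg (hQ0 n) _) ?_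
    (hW ((h - H) / 2) (by linarith))⟩
  filter_upwards [eventually_gt_atTop 0] with n hn
  have hn' : (0 : ℝ) < n := by exact_mod_cast hn
  refine prob_mono (hQ0 n) (hQ n).summable fun x hx hx0 => ?_
  have h1 : Q n x < b ^ (-(n * h)) := by
    by_contra hcon
    exact hx (hA n x (not_lt.1 hcon))
  have h2 := Real.logb_lt_logb hb hx0 h1
  rw [Real.logb_rpow hb0 hb.ne'] at h2
  have h3 : h < (1 / (n : ℝ)) * Real.logb b (Q n x)⁻¹ := by
    rw [one_div, lt_inv_mul_iff₀ hn', Real.logb_inv]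
    linarith
  simp only [Set.mem_ofPred_eq]
  rw [lt_abs]
  left
  linarith

end Coding

lemma entropy_nonneg {X : Type*} {b : ℝ} (hb : 1 < b) {P : X → ℝ} (hP0 : ∀ x, 0 ≤ P x)
    (hP : HasSum P 1) {H : ℝ} (hH : HasSum (fun x => P x * Real.logb b (P x)⁻¹) H) : 0 ≤ H := by
  refine hH.nonneg fun x => mul_nonneg (hP0 x) ?_
  rw [Real.logb_inv, neg_nonneg]
  exact Real.logb_nonpos hb (hP0 x) (le_hasSum hP x fun y _ => hP0 y)

/-- First-order overflow thresholds for a mixture of two i.i.d. sources. -/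
theorem first_order_mixed {U 𝒳 : Type*} [Fintype U] [Countable 𝒳]
    (K : ℕ) (hK : 2 ≤ K) (hcard : Fintype.card U = K)
    (c : U → ℝ) (hc : ∀ u, 0 < c u)
    (α : ℝ) (hα : 0 < α) (hroot : ∑ u : U, (K : ℝ) ^ (-(α * c u)) = 1)
    (P₁ P₂ : 𝒳 → ℝ)
    (hP₁0 : ∀ x, 0 ≤ P₁ x) (hP₁1 : HasSum P₁ 1)
    (hP₂0 : ∀ x, 0 ≤ P₂ x) (hP₂1 : HasSum P₂ 1)
    (H₁ H₂ : ℝ)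
    (hH₁ : HasSum (fun x => P₁ x * Real.logb K (P₁ x)⁻¹) H₁)
    (hH₂ : HasSum (fun x => P₂ x * Real.logb K (P₂ x)⁻¹) H₂)
    (hHord : H₂ ≤ H₁)
    (hWLLN₁ : ∀ δ : ℝ, 0 < δ →
      Filter.Tendsto
        (fun n => prob (fun x : Fin n → 𝒳 => ∏ i, P₁ (x i))
          {x | δ < |(1 / (n : ℝ)) * Real.logb K (∏ i, P₁ (x i))⁻¹ - H₁|})
        Filter.atTop (nhds 0))
    (hWLLN₂ : ∀ δ : ℝ, 0 < δ →
      Filter.Tendsto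
        (fun n => prob (fun x : Fin n → 𝒳 => ∏ i, P₂ (x i))
          {x | δ < |(1 / (n : ℝ)) * Real.logb K (∏ i, P₂ (x i))⁻¹ - H₂|})
        Filter.atTop (nhds 0))
    (w₁ w₂ : ℝ) (hw₁ : 0 < w₁) (hw₂ : 0 < w₂) (hw : w₁ + w₂ = 1)
    (ε : ℝ) (hε0 : 0 ≤ ε) (hε1 : ε < 1) :
    (ε < w₁ →
      sInf {R : ℝ | 0 < R ∧ ∃ φ : ∀ n, (Fin n → 𝒳) → List U,
        (∀ n, Function.Injective (φ n)) ∧ (∀ n x, φ n x ≠ []) ∧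
        (∀ n x y, φ n x <+: φ n y → φ n x = φ n y) ∧
        Filter.limsup
          (fun n => prob
            (fun x : Fin n → 𝒳 => w₁ * ∏ i, P₁ (x i) + w₂ * ∏ i, P₂ (x i))
            {x | (n : ℝ) * R < strCost c (φ n x)}) Filter.atTop ≤ ε}
        = H₁ / α) ∧
    (w₁ ≤ ε →
      sInf {R : ℝ | 0 < R ∧ ∃ φ : ∀ n, (Fin n → 𝒳) → List U,
        (∀ n, Function.Injective (φ n)) ∧ (∀ n x, φ n x ≠ []) ∧
        (∀ n x y, φ n x <+: φ n y → φ n x = φ n y) ∧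
        Filter.limsup
          (fun n => prob
            (fun x : Fin n → 𝒳 => w₁ * ∏ i, P₁ (x i) + w₂ * ∏ i, P₂ (x i))
            {x | (n : ℝ) * R < strCost c (φ n x)}) Filter.atTop ≤ ε}
        = H₂ / α) := by
  have hb : (1 : ℝ) < K := by exact_mod_cast (by omega : 1 < K)
  have : Nontrivial U := Fintype.one_lt_card_iff_nontrivial.1 (by omega)
  have hQ₁0 : ∀ (n : ℕ) (x : Fin n → 𝒳), 0 ≤ ∏ i, P₁ (x i) := fun n x =>
    Finset.prod_nonneg fun i _ => hP₁0 _
  have hQ₂0 : ∀ (n : ℕ) (x : Fin n → 𝒳), 0 ≤ ∏ i, P₂ (x i) := fun n x =>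
    Finset.prod_nonneg fun i _ => hP₂0 _
  have hQ₁ := hasSum_prod_pi hP₁0 hP₁1
  have hQ₂ := hasSum_prod_pi hP₂0 hP₂1
  have hH₂0 : 0 ≤ H₂ := entropy_nonneg hb hP₂0 hP₂1 hH₂
  have hH₁0 : 0 ≤ H₁ := hH₂0.trans hHord
  simp_rw [fun n => prob_add_mul (hQ₁ n).summable (hQ₂ n).summable w₁ w₂]
  have hp1 : ∀ (n : ℕ) S, 0 ≤ prob (fun x : Fin n → 𝒳 => ∏ i, P₁ (x i)) S := fun n S =>
    prob_nonneg (hQ₁0 n) S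
  have hp2 : ∀ (n : ℕ) S, 0 ≤ prob (fun x : Fin n → 𝒳 => ∏ i, P₂ (x i)) S := fun n S =>
    prob_nonneg (hQ₂0 n) S
  have hq1 : ∀ (n : ℕ) S, prob (fun x : Fin n → 𝒳 => ∏ i, P₁ (x i)) S ≤ 1 := fun n S =>
    prob_le_one (hQ₁0 n) (hQ₁ n) S
  have hq2 : ∀ (n : ℕ) S, prob (fun x : Fin n → 𝒳 => ∏ i, P₂ (x i)) S ≤ 1 := fun n S =>
    prob_le_one (hQ₂0 n) (hQ₂ n) S
  have hmix0 : ∀ (n : ℕ) S, 0 ≤ w₁ * prob (fun x : Fin n → 𝒳 => ∏ i, P₁ (x i)) S +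
      w₂ * prob (fun x : Fin n → 𝒳 => ∏ i, P₂ (x i)) S := fun n S =>
    add_nonneg (mul_nonneg hw₁.le (hp1 n S)) (mul_nonneg hw₂.le (hp2 n S))
  have hmix1 : ∀ (n : ℕ) S, w₁ * prob (fun x : Fin n → 𝒳 => ∏ i, P₁ (x i)) S +
      w₂ * prob (fun x : Fin n → 𝒳 => ∏ i, P₂ (x i)) S ≤ 1 := fun n S => by
    have h1 := mul_le_mul_of_nonneg_left (hq1 n S) hw₁.le
    have h2 := mul_le_mul_of_nonneg_left (hq2 n S) hw₂.le
    linarith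
  constructor
  · intro hε
    refine sInf_eq_of_forall_lt_mem (fun R hR => ?_) ?_
    · refine ⟨(div_nonneg hH₁0 hα.le).trans_lt hR, ?_⟩
      rw [div_lt_iff₀ hα] at hR
      obtain ⟨h, hh1, hh2⟩ := exists_between hR
      obtain ⟨A₁, hA₁, hA₁t⟩ := exists_finset_seq_of_wlln hb hQ₁0 hQ₁ hh1 hWLLN₁
      obtain ⟨A₂, hA₂, hA₂t⟩ := exists_finset_seq_of_wlln hb hQ₂0 hQ₂ (hHord.trans_lt hh1) hWLLN₂
      classical
      obtain ⟨φ, hφ, hφc⟩ := exists_isPrefixCode_seq hb hα hc hroot (h := h) (R := R)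
        (by linarith) (by linarith) (fun n => A₁ n ∪ A₂ n) (fun n => by
          have h1 : ((A₁ n ∪ A₂ n).card : ℝ) ≤ (A₁ n).card + (A₂ n).card := by
            exact_mod_cast Finset.card_union_le _ _
          linarith [hA₁ n, hA₂ n])
      refine ⟨φ, fun n => (hφ n).1, fun n => (hφ n).2.1, fun n => (hφ n).2.2, ?_⟩
      refine limsup_le_of_le_tendsto (fun n => hmix0 n _) ?_
        ((hA₁t.const_mul w₁).add (hA₂t.const_mul w₂)) (by simpa using hε0)
      filter_upwards [hφc] with n hn
      refine add_le_add (mul_le_mul_of_nonneg_left ?_ hw₁.le)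
        (mul_le_mul_of_nonneg_left ?_ hw₂.le)
      · refine prob_mono (hQ₁0 n) (hQ₁ n).summable fun x hx _ hxA => ?_
        exact (hn x (Finset.mem_union_left _ hxA)).not_gt hx
      · refine prob_mono (hQ₂0 n) (hQ₂ n).summable fun x hx _ hxA => ?_
        exact (hn x (Finset.mem_union_right _ hxA)).not_gt hx
    · rintro R ⟨-, φ, hi, hne, hp, hlim⟩
      by_contra! hR
      obtain ⟨g, hg, hgle⟩ := exists_tendsto_one_le_overflow hb hα hroot hQ₁0 hQ₁ hWLLN₁
        (fun n => ⟨hi n, hne n, hp n⟩) hR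
      have hle := le_of_tendsto_le_limsup (fun n => hmix1 n _)
        (hgle.mono fun n hn => le_add_of_le_of_nonneg
          (mul_le_mul_of_nonneg_left hn hw₁.le) (mul_nonneg hw₂.le (hp2 n _)))
        (hg.const_mul w₁) hlim
      linarith
  · intro hε
    refine sInf_eq_of_forall_lt_mem (fun R hR => ?_) ?_
    · refine ⟨(div_nonneg hH₂0 hα.le).trans_lt hR, ?_⟩
      rw [div_lt_iff₀ hα] at hR
      obtain ⟨h, hh1, hh2⟩ := exists_between hR
      obtain ⟨A, hA, hAt⟩ := exists_finset_seq_of_wlln hb hQ₂0 hQ₂ hh1 hWLLN₂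
      obtain ⟨φ, hφ, hφc⟩ := exists_isPrefixCode_seq hb hα hc hroot (h := h) (R := R)
        (by linarith) (by linarith) A (fun n => by
          linarith [hA n, Real.rpow_nonneg (by linarith : (0 : ℝ) ≤ K) ((n : ℝ) * h)])
      refine ⟨φ, fun n => (hφ n).1, fun n => (hφ n).2.1, fun n => (hφ n).2.2, ?_⟩
      refine limsup_le_of_le_tendsto (fun n => hmix0 n _) ?_
        ((tendsto_const_nhds (x := w₁ * 1)).add (hAt.const_mul w₂)) (by simpa using hε)
      filter_upwards [hφc] with n hn
      refine add_le_add (mul_le_mul_of_nonneg_left (hq1 n _) hw₁.le)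
        (mul_le_mul_of_nonneg_left ?_ hw₂.le)
      refine prob_mono (hQ₂0 n) (hQ₂ n).summable fun x hx _ hxA => ?_
      exact (hn x hxA).not_gt hx
    · rintro R ⟨-, φ, hi, hne, hp, hlim⟩
      by_contra! hR
      have hφ : ∀ n, IsPrefixCode (φ n) := fun n => ⟨hi n, hne n, hp n⟩
      obtain ⟨g₁, hg₁, hgle₁⟩ := exists_tendsto_one_le_overflow hb hα hroot hQ₁0 hQ₁ hWLLN₁
        hφ (hR.trans_le (div_le_div_of_nonneg_right hHord hα.le))
      obtain ⟨g₂, hg₂, hgle₂⟩ := exists_tendsto_one_le_overflow hb hα hroot hQ₂0 hQ₂ hWLLN₂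
        hφ hR
      have hle := le_of_tendsto_le_limsup (fun n => hmix1 n _)
        ((hgle₁.and hgle₂).mono fun n hn => add_le_add
          (mul_le_mul_of_nonneg_left hn.1 hw₁.le) (mul_le_mul_of_nonneg_left hn.2 hw₂.le))
        ((hg₁.const_mul w₁).add (hg₂.const_mul w₂)) hlim
      linarith
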